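/- Let M, N, P, Q be sets, B ∈ ℕ₊, and let f : M^B × M^B → N factorize as f(ρ, τ) = g(g_o(ρ), g_d(τ)) for all ρ, τ ∈ M^B, where g_o : M^B → P, g_d : M^B → Q and g : P × Q → N. Let k ∈ ℕ with k ≥ 2, h ∈ ℕ₊ with h ≥ k, H : M^h → M a kernel, θ a boundary-handling function, R̃ := (k−1)·B + h − k and R := ⌈R̃/2⌉. Let ξ ∈ M^D with D ≥ B, π := Downsampling_k(Slide_H(Padding_R^θ(ξ))), and r := (R̃ mod 2) − ((D − B + 1 + (R̃ mod 2)) mod k) + (0 if k divides D − B + 1 + (R̃ mod 2), else k). Then r ∈ ℕ, the signal Trimming_r(Upsampling_k(Slide_{g_d}(π))) has exactly D − B + 1 samples, and for every i ∈ {1,…,D−B+1}: f(Subsignal_B(ξ, i), MultiScaleSubsignal_{(B,R,k)}^{(θ,H)}(ξ, MultiScaleIndex_k(i))) = g((Slide_{g_o}(ξ))_i, (Trimming_r(Upsampling_k(Slide_{g_d}(π))))_i). -/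

import Mathlib

namespace Scan

/-- Extraction of the subsignal of length `d` starting at (0-based) index `i`. -/
def subsig {M : Type*} {D : ℕ} (d i : ℕ) (ξ : Fin D → M) (h : i + d ≤ D) : Fin d → M :=
  fun ν => ξ ⟨i + ν.val, by have := ν.isLt; omega⟩

/-- Application of a function in a sliding fashion. -/
def slide {M N : Type*} {c : ℕ} (f : (Fin c → M) → N) {D : ℕ} (ξ : Fin D → M) :
    Fin (D + 1 - c) → N :=
  fun i => f (subsig c i.val ξ (by have := i.isLt; omega))

/-- A boundary-handling function returns the original sample whenever the 1-based
integer index is within bounds. -/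
def IsBoundary {M : Type*} (θ : ∀ D : ℕ, (Fin D → M) → ℤ → M) : Prop :=
  ∀ (D : ℕ) (ξ : Fin D → M) (ν : ℤ) (h1 : 1 ≤ ν) (h2 : ν ≤ (D : ℤ)),
    θ D ξ ν = ξ ⟨ν.toNat - 1, by omega⟩

/-- The padding operator: the `ν`-th sample (1-based) of `Padding_R^θ(ξ)` is
`θ(ξ, ν − R)`. -/
def padth {M : Type*} (θ : ∀ D : ℕ, (Fin D → M) → ℤ → M) (R : ℕ) {D : ℕ}
    (ξ : Fin D → M) : Fin (D + 2 * R) → M :=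
  fun ν => θ D ξ ((ν.val : ℤ) + 1 - R)

/-- The padded subsignal extraction operator: the `ν`-th sample (1-based) of
`SubsignalPad_{(d,R)}^θ(ξ, i)` is `θ(ξ, i + ν − R − 1)`; here `i` is 0-based
(the paper's subsignal index is `i + 1`). -/
def subsigPad {M : Type*} (θ : ∀ D : ℕ, (Fin D → M) → ℤ → M) (d R : ℕ) {D : ℕ}
    (ξ : Fin D → M) (i : ℕ) : Fin (d + 2 * R) → M :=
  fun ν => θ D ξ ((i : ℤ) + (ν.val : ℤ) + 1 - R)

/-- The downsampling operator: the `ν`-th sample (1-based) of `Downsampling_k(ξ)`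
is `ξ_{k(ν−1)+1}`; the output has `⌈D/k⌉ = (D + k − 1)/k` samples. -/
def downs {M : Type*} (k : ℕ) {D : ℕ} (ξ : Fin D → M) : Fin ((D + k - 1) / k) → M :=
  fun ν => ξ ⟨k * ν.val, by
    have hν := ν.isLt
    rcases Nat.eq_zero_or_pos k with hk | hk
    · subst hk; omega
    · have h1 : k * (ν.val + 1) ≤ k * ((D + k - 1) / k) := Nat.mul_le_mul_left k hν
      have h2 : ((D + k - 1) / k) * k ≤ D + k - 1 := Nat.div_mul_le_self _ k
      have h3 : k * ((D + k - 1) / k) = ((D + k - 1) / k) * k := Nat.mul_comm _ _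
      have h4 : k * (ν.val + 1) = k * ν.val + k := Nat.mul_succ k ν.val
      omega⟩

/-- The multi-scale subsignal index transformation (0-based: the paper's 1-based
`MultiScaleIndex_k(i) = k⌊(i−1)/k⌋ + 1` becomes `i ↦ k·⌊i/k⌋`). -/
def msIdx (k i : ℕ) : ℕ := k * (i / k)

/-- The multi-scale subsignal extraction operator
`MultiScaleSubsignal_{(d,R,k)}^{(θ,H)}(ξ, i) =
Downsampling_k(Slide_H(SubsignalPad_{(d,R)}^θ(ξ, i)))`. -/
def msSub {M : Type*} (θ : ∀ D : ℕ, (Fin D → M) → ℤ → M) {h : ℕ}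
    (H : (Fin h → M) → M) (d R k : ℕ) {D : ℕ} (ξ : Fin D → M) (i : ℕ) :
    Fin ((d + 2 * R + 1 - h + k - 1) / k) → M :=
  downs k (slide H (subsigPad θ d R ξ i))

/-- The upsampling operator with zero-order hold. -/
def upsample {M : Type*} (k : ℕ) {q : ℕ} (ξ : Fin q → M) : Fin (k * q) → M :=
  fun ν => ξ ⟨ν.val / k, Nat.div_lt_of_lt_mul ν.isLt⟩

/-- The trimming operator: remove the final `r` samples. -/
def trim {A : Type*} (r : ℕ) {D : ℕ} (ξ : Fin D → A) : Fin (D - r) → A :=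
  fun i => ξ ⟨i.val, by have := i.isLt; omega⟩

theorem ceilDiv_add_mul_succ {k : ℕ} (hk : 0 < k) (m b : ℕ) :
    (m + k * b + k - 1) / k = (m + k - 1) / k + b := by
  rw [show m + k * b + k - 1 = m + k - 1 + k * b by omega, Nat.add_mul_div_left _ _ hk]

/-- Rounding `m` up to a multiple of `k` adds `k - m % k` unless `k ∣ m`. -/
theorem mul_ceilDiv_add_mod {k : ℕ} (hk : 0 < k) (m : ℕ) :
    k * ((m + k - 1) / k) + m % k = m + if k ∣ m then 0 else k := by
  have hm := Nat.div_add_mod m k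
  have hlt := Nat.mod_lt m hk
  split_ifs with h
  · have h0 := Nat.mod_eq_zero_of_dvd h
    have hq : (m + k - 1) / k = m / k := by
      rw [show m + k - 1 = k - 1 + k * (m / k) by omega, Nat.add_mul_div_left _ _ hk,
        Nat.div_eq_of_lt (by omega), zero_add]
    rw [hq]
    omega
  · have h0 : m % k ≠ 0 := fun h0 => h (Nat.dvd_of_mod_eq_zero h0)
    have hq : (m + k - 1) / k = m / k + 1 := by
      rw [show m + k - 1 = m % k - 1 + k * (m / k + 1) by rw [Nat.mul_succ]; omega,
        Nat.add_mul_div_left _ _ hk, Nat.div_eq_of_lt (by omega), zero_add]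
    rw [hq, Nat.mul_succ]
    omega

/-- efficient multi-scale evaluation.  Suppose the two-scale
function `f` factorizes as `f(ρ, τ) = g(g_o(ρ), g_d(τ))`.  With
`R̃ = (k−1)B + h − k`, `R = ⌈R̃/2⌉`, `π = Downsampling_k(Slide_H(Padding_R^θ(ξ)))`
and `r` as given, one has `r ∈ ℕ` (i.e. `0 ≤ r`),
`Trimming_r(Upsampling_k(Slide_{g_d}(π)))` has exactly `D − B + 1` samples,
the multi-scale subsignal has exactly `B` samples, and for every valid `i`
(0-based) and every signal `τ ∈ M^B` that coincides with
`MultiScaleSubsignal_{(B,R,k)}^{(θ,H)}(ξ, MultiScaleIndex_k(i))`: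
`f(Subsignal_B(ξ, i), τ) = g((Slide_{g_o}(ξ))_i, (Trimming_r(Upsampling_k(Slide_{g_d}(π))))_i)`. -/
theorem multiscale_eval {M N P Q : Type*} (k hsz B : ℕ) (hk : 2 ≤ k) (hhk : k ≤ hsz)
    (hB : 0 < B)
    (f : (Fin B → M) → (Fin B → M) → N)
    (go : (Fin B → M) → P) (gd : (Fin B → M) → Q) (g : P → Q → N)
    (hfac : ∀ ρ τ : Fin B → M, f ρ τ = g (go ρ) (gd τ))
    (θ : ∀ D : ℕ, (Fin D → M) → ℤ → M) (hθ : IsBoundary θ)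
    (H : (Fin hsz → M) → M)
    (R' R : ℕ) (hR' : R' = (k - 1) * B + hsz - k) (hR : R = (R' + 1) / 2)
    {D : ℕ} (hD : B ≤ D) (ξ : Fin D → M)
    (r : ℤ)
    (hr : r = ((R' % 2 : ℕ) : ℤ) - (((D - B + 1 + R' % 2) % k : ℕ) : ℤ) +
      (if k ∣ (D - B + 1 + R' % 2) then (0 : ℤ) else (k : ℤ))) :
    (0 ≤ r) ∧
    (k * ((D + 2 * R + 1 - hsz + k - 1) / k + 1 - B) - r.toNat = D - B + 1) ∧
    ((B + 2 * R + 1 - hsz + k - 1) / k = B) ∧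
    (∀ (i : ℕ) (hiB : i + B ≤ D) (τ : Fin B → M),
      (∀ (ν : ℕ) (hν1 : ν < B) (hν2 : ν < (B + 2 * R + 1 - hsz + k - 1) / k),
        τ ⟨ν, hν1⟩ = msSub θ H B R k ξ (msIdx k i) ⟨ν, hν2⟩) →
      ∀ (h1 : i < D + 1 - B)
        (h2 : i < k * ((D + 2 * R + 1 - hsz + k - 1) / k + 1 - B) - r.toNat),
        f (subsig B i ξ hiB) τ =
          g (slide go ξ ⟨i, h1⟩)
            (trim r.toNat (upsample k (slide gd (downs k (slide H (padth θ R ξ)))))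
              ⟨i, h2⟩)) := by
  have hk0 : 0 < k := by omega
  obtain ⟨b, rfl⟩ : ∃ b, B = b + 1 := ⟨B - 1, by omega⟩
  have hmul : (k - 1) * (b + 1) + (b + 1) = k * b + k := by
    obtain ⟨c, rfl⟩ : ∃ c, k = c + 1 := ⟨k - 1, by omega⟩
    rw [Nat.add_sub_cancel]
    ring
  have hlen : ∀ E : ℕ, b + 1 ≤ E →
      (E + 2 * R + 1 - hsz + k - 1) / k = (E - (b + 1) + 1 + R' % 2 + k - 1) / k + b := by
    intro E hE
    rw [← ceilDiv_add_mul_succ hk0]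
    congr 3
    omega
  have hround := mul_ceilDiv_add_mod hk0 (D - (b + 1) + 1 + R' % 2)
  have hmod := Nat.mod_lt (D - (b + 1) + 1 + R' % 2) hk0
  have hr' : r + (D - (b + 1) + 1 : ℕ) =
      (k * ((D - (b + 1) + 1 + R' % 2 + k - 1) / k) : ℕ) := by
    rw [hr]
    split_ifs at hround ⊢ <;> omega
  have hr0 : 0 ≤ r := by
    rw [hr]
    split_ifs with h
    · have := Nat.mod_eq_zero_of_dvd h
      omega
    · omega
  refine ⟨hr0, ?_, ?_, ?_⟩
  · rw [hlen D hD, Nat.add_assoc, Nat.add_sub_cancel]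
    omega
  · rw [hlen (b + 1) le_rfl, Nat.sub_self, Nat.add_comm]
    congr 1
    exact Nat.div_eq_of_lt_le (by omega) (by omega)
  · intro i hiB τ hτ h1 h2
    have hcount := hlen (b + 1) le_rfl
    have hone : 1 ≤ (b + 1 - (b + 1) + 1 + R' % 2 + k - 1) / k :=
      (Nat.one_le_div_iff hk0).2 (by omega)
    rw [hfac]
    refine congrArg (g _) (congrArg gd (funext fun ν => ?_))
    refine (hτ ν ν.isLt (by have := ν.isLt; omega)).trans (congrArg H (funext fun μ => ?_))
    refine congrArg (θ D ξ) ?_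
    simp only [msIdx]
    push_cast
    ring

end Scan
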